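/- Let N be an odd natural number and v : Fin N → ℝ a nonzero vector with J_N.mulVec v = ((N² − 1)/2 : ℝ) • v. Then v is fixed by the binomial transform: (Ψ_N * Λ_N).mulVec v = v. -/

import Mathlib

open Matrix

/-- The `N × N` symmetric Pascal matrix, `(T_N)_{jk} = C(j+k, j)`. -/
noncomputable def pascalT (N : ℕ) : Matrix (Fin N) (Fin N) ℝ :=
  fun j k => (Nat.choose (j.1 + k.1) j.1 : ℝ)

/-- The `N × N` lower-triangular Pascal matrix, `(Ψ_N)_{jk} = C(j, k)`. -/
noncomputable def psiMat (N : ℕ) : Matrix (Fin N) (Fin N) ℝ :=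
  fun j k => (Nat.choose j.1 k.1 : ℝ)

/-- The `N × N` diagonal sign matrix `Λ_N = diag(1, -1, 1, …)`. -/
noncomputable def lamMat (N : ℕ) : Matrix (Fin N) (Fin N) ℝ :=
  Matrix.diagonal fun j => (-1 : ℝ) ^ j.1

/-- The `N × N` symmetric tridiagonal (Jacobi) matrix `J_N` with diagonal entries
`(J_N)_{jj} = -N²·j + 2j³ + 3j² + 2j` and off-diagonal entries
`(J_N)_{j,j+1} = (J_N)_{j+1,j} = (j+1)·(N² - (j+1)²)`. -/
noncomputable def jacobiJ (N : ℕ) : Matrix (Fin N) (Fin N) ℝ :=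
  fun j k =>
    if j.1 = k.1 then
      -((N : ℝ) ^ 2) * (j.1 : ℝ) + 2 * (j.1 : ℝ) ^ 3 + 3 * (j.1 : ℝ) ^ 2 + 2 * (j.1 : ℝ)
    else if j.1 + 1 = k.1 then (k.1 : ℝ) * ((N : ℝ) ^ 2 - (k.1 : ℝ) ^ 2)
    else if k.1 + 1 = j.1 then (j.1 : ℝ) * ((N : ℝ) ^ 2 - (j.1 : ℝ) ^ 2)
    else 0

/-- The action of `J_N` on a sequence restricted to `Fin N`, as a three-term expression. -/
theorem sum_jacobiJ_mul (N : ℕ) (g : ℕ → ℝ) (k : Fin N) :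
    ∑ l : Fin N, jacobiJ N k l * g l =
      (-((N : ℝ) ^ 2) * k + 2 * (k : ℝ) ^ 3 + 3 * (k : ℝ) ^ 2 + 2 * k) * g k
      + k * ((N : ℝ) ^ 2 - (k : ℝ) ^ 2) * g (k - 1)
      + (k + 1) * ((N : ℝ) ^ 2 - ((k : ℝ) + 1) ^ 2) * g (k + 1) := by
  obtain ⟨k, hk⟩ := k
  let f : ℕ → ℝ := fun l =>
    (if l = k then
      (-((N : ℝ) ^ 2) * k + 2 * (k : ℝ) ^ 3 + 3 * (k : ℝ) ^ 2 + 2 * k) * g k else 0)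
    + (if l = k - 1 then k * ((N : ℝ) ^ 2 - (k : ℝ) ^ 2) * g (k - 1) else 0)
    + (if l = k + 1 then (k + 1) * ((N : ℝ) ^ 2 - ((k : ℝ) + 1) ^ 2) * g (k + 1) else 0)
  have hsplit : ∀ l : Fin N, jacobiJ N ⟨k, hk⟩ l * g l = f l := by
    rintro ⟨l, hl⟩
    simp only [jacobiJ, f]
    rcases Nat.lt_trichotomy l k with hlk | rfl | hlk
    · rcases eq_or_ne (l + 1) k with rfl | hne
      · rw [if_neg (by omega), if_neg (by omega), if_pos rfl, if_neg (by omega), if_pos (by omega),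
          if_neg (by omega)]
        simp
      · rw [if_neg (by omega), if_neg (by omega), if_neg (by omega), if_neg (by omega),
          if_neg (by omega), if_neg (by omega)]
        simp
    · rcases Nat.eq_zero_or_pos l with rfl | hpos
      · simp
      · rw [if_pos rfl, if_pos rfl, if_neg (by omega), if_neg (by omega)]
        simp
    · rcases eq_or_ne l (k + 1) with rfl | hne
      · rw [if_neg (by omega), if_pos rfl, if_neg (by omega), if_neg (by omega), if_pos rfl]
        push_cast
        ring
      · rw [if_neg (by omega), if_neg (by omega), if_neg (by omega), if_neg (by omega),
          if_neg (by omega), if_neg (by omega)]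
        simp
  rw [Finset.sum_congr rfl fun l _ => hsplit l, Fin.sum_univ_eq_sum_range f, Finset.sum_add_distrib,
    Finset.sum_add_distrib, Finset.sum_ite_eq', Finset.sum_ite_eq', Finset.sum_ite_eq',
    if_pos (Finset.mem_range.2 hk), if_pos (Finset.mem_range.2 (by omega))]
  congr 1
  split_ifs with hk1
  · rfl
  · have hN : N = k + 1 := by rw [Finset.mem_range] at hk1; omega
    subst hN
    push_cast
    ring

theorem jacobiJ_comm (N : ℕ) (j k : Fin N) : jacobiJ N j k = jacobiJ N k j := by
  simp only [jacobiJ]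
  split_ifs with h₁ <;> first | rfl | omega | simp [h₁]

theorem psiMat_mul_lamMat_apply (N : ℕ) (j k : Fin N) :
    (psiMat N * lamMat N) j k = (Nat.choose j k : ℝ) * (-1) ^ (k : ℕ) := by
  simp [psiMat, lamMat, Matrix.mul_diagonal]

theorem cast_mul_choose_pred (j k : ℕ) :
    (j : ℝ) * (j - 1).choose k = ((j : ℝ) - k) * j.choose k := by
  rcases j with _ | j
  · rcases k with _ | k <;> simp
  · rcases le_or_gt k (j + 1) with hk | hk
    · have h : (j.choose k : ℝ) * (j + 1) = (j + 1).choose k * ((j + 1 : ℕ) - k) := by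
        rw [← Nat.cast_sub hk]
        exact_mod_cast Nat.choose_mul_succ_eq j k
      rw [Nat.add_sub_cancel]
      push_cast at h ⊢
      linear_combination h
    · simp [Nat.choose_eq_zero_of_lt hk, Nat.choose_eq_zero_of_lt (by omega : j < k)]

theorem cast_succ_mul_choose_succ (j k : ℕ) :
    ((k : ℝ) + 1) * j.choose (k + 1) = ((j : ℝ) - k) * j.choose k := by
  have h₁ : ((j : ℝ) + 1) * j.choose k = (j + 1).choose (k + 1) * ((k : ℝ) + 1) := by
    exact_mod_cast Nat.add_one_mul_choose_eq j k
  rw [Nat.choose_succ_succ'] at h₁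
  push_cast at h₁
  linear_combination -h₁

/-- The coefficient identity behind the anticommutation of `J_N - (N² - 1) / 2` with `Ψ_N Λ_N`. -/
theorem choose_jacobi_identity (n : ℝ) (j k : ℕ) :
    (-n ^ 2 * k + 2 * (k : ℝ) ^ 3 + 3 * (k : ℝ) ^ 2 + 2 * k) * (j.choose k * (-1) ^ k)
      + k * (n ^ 2 - (k : ℝ) ^ 2) * (j.choose (k - 1) * (-1) ^ (k - 1))
      + (k + 1) * (n ^ 2 - ((k : ℝ) + 1) ^ 2) * (j.choose (k + 1) * (-1) ^ (k + 1))
      + ((-n ^ 2 * j + 2 * (j : ℝ) ^ 3 + 3 * (j : ℝ) ^ 2 + 2 * j) * (j.choose k * (-1) ^ k)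
      + j * (n ^ 2 - (j : ℝ) ^ 2) * ((j - 1).choose k * (-1) ^ k)
      + (j + 1) * (n ^ 2 - ((j : ℝ) + 1) ^ 2) * ((j + 1).choose k * (-1) ^ k))
      = (n ^ 2 - 1) * (j.choose k * (-1) ^ k) := by
  have h₁ := cast_mul_choose_pred j k
  have h₂ := cast_succ_mul_choose_succ j k
  rcases k with _ | k
  · simp only [Nat.choose_zero_right, Nat.cast_zero, Nat.cast_one, zero_add, pow_one, pow_zero]
      at h₁ h₂ ⊢
    linear_combination (n ^ 2 - (j : ℝ) ^ 2) * h₁ - (n ^ 2 - 1) * h₂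
  · have h₃ := cast_succ_mul_choose_succ j k
    simp only [Nat.choose_succ_succ' j k, Nat.add_sub_cancel, pow_succ] at h₁ h₂ h₃ ⊢
    push_cast at h₁ h₂ h₃ ⊢
    linear_combination (-1) ^ k * (-(n ^ 2 - (j : ℝ) ^ 2) * h₁
      + (n ^ 2 - ((k : ℝ) + 2) ^ 2) * h₂
      + (n ^ 2 - (((j : ℝ) + 1) ^ 2 + (j + 1) * (k + 1) + (k + 1) ^ 2)) * h₃)

theorem binomialTransform_mul_jacobiJ (N : ℕ) :
    psiMat N * lamMat N * jacobiJ N + jacobiJ N * (psiMat N * lamMat N) =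
      ((N : ℝ) ^ 2 - 1) • (psiMat N * lamMat N) := by
  ext j k
  rw [Matrix.add_apply, Matrix.smul_apply, Matrix.mul_apply (M := psiMat N * lamMat N),
    Matrix.mul_apply (M := jacobiJ N), smul_eq_mul]
  simp only [psiMat_mul_lamMat_apply]
  rw [sum_jacobiJ_mul N (fun l => (Nat.choose l k : ℝ) * (-1) ^ (k : ℕ)) j,
    Finset.sum_congr rfl fun (l : Fin N) _ => (by rw [jacobiJ_comm, mul_comm] :
      (Nat.choose j l : ℝ) * (-1) ^ (l : ℕ) * jacobiJ N l k =
        jacobiJ N k l * ((Nat.choose j l : ℝ) * (-1) ^ (l : ℕ))),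
    sum_jacobiJ_mul N (fun l => (Nat.choose j l : ℝ) * (-1) ^ (l : ℕ)) k]
  exact choose_jacobi_identity N j k

/-- An eigenvector of `J_N` is determined by its first entry. -/
theorem eq_zero_of_jacobiJ_mulVec (N : ℕ) (μ : ℝ) (w : Fin N → ℝ)
    (h : (jacobiJ N).mulVec w = μ • w) (h₀ : ∀ i : Fin N, i.1 = 0 → w i = 0) : w = 0 := by
  let g : ℕ → ℝ := fun l => if hl : l < N then w ⟨l, hl⟩ else 0
  have hg : ∀ l : Fin N, g l = w l := fun l => by simp [g]
  have hrec := fun k : Fin N => (sum_jacobiJ_mul N g k).symm.trans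
    ((Finset.sum_congr rfl fun l _ => by rw [hg]).trans (congrFun h k))
  have hzero : ∀ k, k < N → g k = 0 := by
    intro k
    induction k using Nat.strong_induction_on with
    | _ k ih =>
      intro hk
      rcases k with _ | k
      · simpa [g, hk] using h₀ ⟨0, hk⟩ rfl
      · have hr := hrec ⟨k, by omega⟩
        rw [Pi.smul_apply, ← hg] at hr
        simp only [ih k (by omega) (by omega), ih (k - 1) (by omega) (by omega), mul_zero,
          smul_zero, zero_add] at hr
        have hlt : (k : ℝ) + 1 < N := by exact_mod_cast hk
        have hk0 : (0 : ℝ) ≤ k := k.cast_nonneg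
        refine (mul_eq_zero.1 hr).resolve_left (mul_ne_zero (by positivity) ?_)
        nlinarith
  funext l
  rw [← hg, hzero l l.2, Pi.zero_apply]

/-- If `N` is odd and `v` is a nonzero eigenvector of `J_N` with eigenvalue `(N² - 1)/2`,
then `v` is fixed by the binomial transform `Ψ_N Λ_N`. -/
theorem middle_eigenvector_fixed_by_binomial_transform (N : ℕ) (hN : Odd N)
    (v : Fin N → ℝ) (hv : v ≠ 0)
    (h : (jacobiJ N).mulVec v = (((N : ℝ) ^ 2 - 1) / 2) • v) :
    (psiMat N * lamMat N).mulVec v = v := by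
  have hP := congrArg (fun M => M.mulVec v) (binomialTransform_mul_jacobiJ N)
  simp only [Matrix.add_mulVec, Matrix.smul_mulVec, ← Matrix.mulVec_mulVec _ _ (jacobiJ N), h,
    ← Matrix.mulVec_mulVec v (jacobiJ N), Matrix.mulVec_smul] at hP
  refine sub_eq_zero.1 (eq_zero_of_jacobiJ_mulVec N (((N : ℝ) ^ 2 - 1) / 2) _ ?_ ?_)
  · rw [Matrix.mulVec_sub, h, eq_sub_of_add_eq' hP]
    module
  · rintro ⟨i, hi⟩ rfl
    rw [Pi.sub_apply, sub_eq_zero, Matrix.mulVec, dotProduct,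
      Finset.sum_eq_single ⟨0, hi⟩ _ (by simp)]
    · simp [psiMat_mul_lamMat_apply]
    · rintro ⟨l, hl⟩ _ hne
      have : l ≠ 0 := fun h => hne (by simp [h])
      simp [psiMat_mul_lamMat_apply, Nat.choose_eq_zero_of_lt (Nat.pos_of_ne_zero this)]
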